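/- Let μ > 0, let G, H : [0,1] → ℝ be nonnegative and integrable, and let a, b, c : [0,1] → [0,1] be measurable. Then there is no function ψ : ℝ → ℝ that is infinitely differentiable on a neighborhood of 0, satisfies ψ(0) = 1 and (-1)^n ψ^{(n)}(0) > 0 for every n ≥ 1, and satisfies, for all x ≥ 0, -μ x ψ'(x) = ∫₀¹ G(s) [ψ(a(s)x) ψ(b(s)x) - ψ(x)] ds + ∫₀¹ H(s) [ψ(c(s)x) - ψ(x)] ds. -/

import Mathlib

open Real MeasureTheory

open Polynomial in
/-- The `j`-th coefficient of the polynomial `x ↦ p (a x) * p (b x)`. -/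
noncomputable def dilatedMulCoeff (p : ℝ[X]) (j : ℕ) (a b : ℝ) : ℝ :=
  ∑ kl ∈ Finset.HasAntidiagonal.antidiagonal j, p.coeff kl.1 * a ^ kl.1 * (p.coeff kl.2 * b ^ kl.2)

open Polynomial in
lemma eval_mul_eval_eq_sum_dilatedMulCoeff {p : ℝ[X]} {n : ℕ} (hp : p.natDegree ≤ n)
    (a b x : ℝ) :
    p.eval (a * x) * p.eval (b * x) =
      ∑ j ∈ Finset.range (2 * n + 1), dilatedMulCoeff p j a b * x ^ j := by
  have key (c : ℝ) : (p.comp (C c * X)).natDegree ≤ n := by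
    refine natDegree_comp_le.trans ?_
    have h : (C c * X).natDegree ≤ 1 := natDegree_C_mul_le c X |>.trans natDegree_X_le
    nlinarith
  have hdeg : (p.comp (C a * X) * p.comp (C b * X)).natDegree < 2 * n + 1 := by
    have := natDegree_mul_le (p := p.comp (C a * X)) (q := p.comp (C b * X))
    have := key a
    have := key b
    omega
  have h := eval_eq_sum_range' hdeg x
  simpa [coeff_mul, comp_C_mul_X_coeff, dilatedMulCoeff] using h

open Polynomial in
lemma abs_dilatedMulCoeff_le (p : ℝ[X]) (j : ℕ) {a b : ℝ} (ha : a ∈ Set.Icc (0 : ℝ) 1)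
    (hb : b ∈ Set.Icc (0 : ℝ) 1) :
    |dilatedMulCoeff p j a b| ≤
      ∑ kl ∈ Finset.HasAntidiagonal.antidiagonal j, |p.coeff kl.1| * |p.coeff kl.2| := by
  refine (Finset.abs_sum_le_sum_abs _ _).trans (Finset.sum_le_sum fun kl _ ↦ ?_)
  rw [abs_mul, abs_mul, abs_mul]
  have h1 : |a ^ kl.1| ≤ 1 := by
    rw [abs_of_nonneg (pow_nonneg ha.1 _)]; exact pow_le_one₀ ha.1 ha.2
  have h2 : |b ^ kl.2| ≤ 1 := by
    rw [abs_of_nonneg (pow_nonneg hb.1 _)]; exact pow_le_one₀ hb.1 hb.2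
  exact mul_le_mul (mul_le_of_le_one_right (abs_nonneg _) h1)
    (mul_le_of_le_one_right (abs_nonneg _) h2) (by positivity) (abs_nonneg _)

open Polynomial in
lemma integrable_mul_dilatedMulCoeff_sub {ν : Measure ℝ} {G a b : ℝ → ℝ} (hG : Integrable G ν)
    (ha : Measurable a) (hb : Measurable b)
    (ha1 : ∀ᵐ s ∂ν, a s ∈ Set.Icc (0 : ℝ) 1) (hb1 : ∀ᵐ s ∂ν, b s ∈ Set.Icc (0 : ℝ) 1)
    (p : ℝ[X]) (j : ℕ) (t : ℝ) :
    Integrable (fun s ↦ G s * (dilatedMulCoeff p j (a s) (b s) - t)) ν := by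
  refine hG.mul_bdd
    (c := (∑ kl ∈ Finset.HasAntidiagonal.antidiagonal j, |p.coeff kl.1| * |p.coeff kl.2|) + |t|) ?_ ?_
  · unfold dilatedMulCoeff
    exact Measurable.aestronglyMeasurable (by fun_prop)
  · filter_upwards [ha1, hb1] with s h1 h2
    exact (abs_sub _ _).trans (add_le_add (abs_dilatedMulCoeff_le p j h1 h2) le_rfl)

/-- A polynomial function that is `O(x ^ (n + 1))` as `x → 0+` has no terms of degree `≤ n`. -/
lemma coeff_eq_zero_of_abs_sum_le {δ K : ℝ} (hδ : 0 < δ) (n : ℕ) :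
    ∀ {N : ℕ} {r : ℕ → ℝ},
      (∀ x ∈ Set.Ioc 0 δ, |∑ j ∈ Finset.range N, r j * x ^ j| ≤ K * x ^ (n + 1)) →
      ∀ j ≤ n, j < N → r j = 0 := by
  have base {m N : ℕ} {r : ℕ → ℝ}
      (h : ∀ x ∈ Set.Ioc 0 δ, |∑ j ∈ Finset.range (N + 1), r j * x ^ j| ≤ K * x ^ (m + 1)) :
      r 0 = 0 := by
    have hl : Filter.Tendsto (fun x : ℝ ↦ |∑ j ∈ Finset.range (N + 1), r j * x ^ j|)
        (nhdsWithin 0 (Set.Ioi 0)) (nhds |r 0|) := by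
      have hc : Continuous fun x : ℝ ↦ |∑ j ∈ Finset.range (N + 1), r j * x ^ j| := by fun_prop
      have := hc.tendsto 0
      rw [Finset.sum_range_succ'] at this
      simpa using this.mono_left nhdsWithin_le_nhds
    have hr : Filter.Tendsto (fun x : ℝ ↦ K * x ^ (m + 1)) (nhdsWithin 0 (Set.Ioi 0)) (nhds 0) := by
      have hc : Continuous fun x : ℝ ↦ K * x ^ (m + 1) := by fun_prop
      have := hc.tendsto 0
      simpa using this.mono_left nhdsWithin_le_nhds
    have := le_of_tendsto_of_tendsto hl hr
      (Filter.eventually_of_mem (Ioc_mem_nhdsGT hδ) h)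
    exact abs_nonpos_iff.mp this
  induction n with
  | zero =>
    intro N r h j hj hjN
    obtain rfl : j = 0 := by omega
    obtain ⟨N, rfl⟩ : ∃ M, N = M + 1 := ⟨N - 1, by omega⟩
    exact base h
  | succ n ih =>
    intro N r h j hj hjN
    obtain ⟨N, rfl⟩ : ∃ M, N = M + 1 := ⟨N - 1, by omega⟩
    have h0 := base h
    cases j with
    | zero => exact h0
    | succ j =>
      refine ih (N := N) (r := fun i ↦ r (i + 1)) (fun x hx ↦ ?_) j (by omega) (by omega)
      have h1 := h x hx
      rw [Finset.sum_range_succ', h0, zero_mul, add_zero] at h1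
      have h2 : ∑ i ∈ Finset.range N, r (i + 1) * x ^ (i + 1)
          = x * ∑ i ∈ Finset.range N, r (i + 1) * x ^ i := by
        rw [Finset.mul_sum]
        exact Finset.sum_congr rfl fun i _ ↦ by ring
      rw [h2, abs_mul, abs_of_pos hx.1] at h1
      refine le_of_mul_le_mul_left (h1.trans_eq ?_) hx.1
      ring

open Polynomial in
/-- Replacing `f` by its Taylor polynomial `p` in the collision operator costs `O(x ^ (n + 1))`. -/
lemma exists_abs_integral_sub_sum_le {ν : Measure ℝ} {G a b f : ℝ → ℝ} (hG : Integrable G ν)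
    (ha : Measurable a) (hb : Measurable b)
    (ha1 : ∀ᵐ s ∂ν, a s ∈ Set.Icc (0 : ℝ) 1) (hb1 : ∀ᵐ s ∂ν, b s ∈ Set.Icc (0 : ℝ) 1)
    (hf : Continuous f) {p : ℝ[X]} {n : ℕ} (hp : p.natDegree ≤ n) {δ C : ℝ}
    (hC : 0 ≤ C) (hfp : ∀ x ∈ Set.Icc 0 δ, |f x - p.eval x| ≤ C * x ^ (n + 1)) :
    ∃ K, ∀ x ∈ Set.Icc 0 δ,
      |(∫ s, G s * (f (a s * x) * f (b s * x) - f x) ∂ν) -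
        ∑ j ∈ Finset.range (2 * n + 1),
          (∫ s, G s * (dilatedMulCoeff p j (a s) (b s) - p.coeff j) ∂ν) * x ^ j|
        ≤ K * x ^ (n + 1) := by
  obtain ⟨B, hB⟩ := isCompact_Icc.exists_bound_of_continuousOn
    (s := Set.Icc 0 δ) hf.continuousOn
  obtain ⟨B', hB'⟩ := isCompact_Icc.exists_bound_of_continuousOn
    (s := Set.Icc 0 δ) p.continuous.continuousOn
  simp only [Real.norm_eq_abs] at hB hB'
  refine ⟨(∫ s, |G s| ∂ν) * ((B + B' + 1) * C), fun x hx ↦ ?_⟩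
  have hmem {t : ℝ} (ht : t ∈ Set.Icc (0 : ℝ) 1) : t * x ∈ Set.Icc 0 δ :=
    ⟨mul_nonneg ht.1 hx.1, (mul_le_of_le_one_left hx.1 ht.2).trans hx.2⟩
  have hle {t : ℝ} (ht : t ∈ Set.Icc (0 : ℝ) 1) :
      |f (t * x) - p.eval (t * x)| ≤ C * x ^ (n + 1) :=
    (hfp _ (hmem ht)).trans <| mul_le_mul_of_nonneg_left
      (pow_le_pow_left₀ (hmem ht).1 (mul_le_of_le_one_left hx.1 ht.2) _) hC
  have hB0 : 0 ≤ B := (abs_nonneg _).trans (hB x hx)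
  have hint : Integrable (fun s ↦ G s * (f (a s * x) * f (b s * x) - f x)) ν := by
    refine hG.mul_bdd (c := B * B + B) ?_ ?_
    · exact Measurable.aestronglyMeasurable (by fun_prop)
    · filter_upwards [ha1, hb1] with s h1 h2
      refine (abs_sub _ _).trans (add_le_add ?_ (hB x hx))
      rw [abs_mul]
      exact mul_le_mul (hB _ (hmem h1)) (hB _ (hmem h2)) (abs_nonneg _) hB0
  have hterm (j : ℕ) := (integrable_mul_dilatedMulCoeff_sub hG ha hb ha1 hb1 p j
    (p.coeff j)).mul_const (x ^ j)
  have hsum : ∑ j ∈ Finset.range (2 * n + 1),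
      (∫ s, G s * (dilatedMulCoeff p j (a s) (b s) - p.coeff j) ∂ν) * x ^ j =
      ∫ s, ∑ j ∈ Finset.range (2 * n + 1),
        G s * (dilatedMulCoeff p j (a s) (b s) - p.coeff j) * x ^ j ∂ν := by
    rw [integral_finsetSum _ fun j _ ↦ hterm j]
    simp only [integral_mul_const]
  rw [hsum, ← integral_sub hint (integrable_finsetSum _ fun j _ ↦ hterm j)]
  have hbound : ∫ s, |G s| * ((B + B' + 1) * C * x ^ (n + 1)) ∂ν =
      (∫ s, |G s| ∂ν) * ((B + B' + 1) * C) * x ^ (n + 1) := by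
    rw [integral_mul_const]; ring
  rw [← hbound, ← Real.norm_eq_abs]
  refine norm_integral_le_of_norm_le (hG.abs.mul_const _) ?_
  filter_upwards [ha1, hb1] with s h1 h2
  have hpoly : ∑ j ∈ Finset.range (2 * n + 1),
      G s * (dilatedMulCoeff p j (a s) (b s) - p.coeff j) * x ^ j =
      G s * (p.eval (a s * x) * p.eval (b s * x) - p.eval x) := by
    rw [eval_mul_eval_eq_sum_dilatedMulCoeff hp,
      eval_eq_sum_range' (show p.natDegree < 2 * n + 1 by omega) x, ← Finset.sum_sub_distrib,
      Finset.mul_sum]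
    exact Finset.sum_congr rfl fun j _ ↦ by ring
  rw [hpoly, ← mul_sub, Real.norm_eq_abs, abs_mul]
  refine mul_le_mul_of_nonneg_left ?_ (abs_nonneg _)
  have hsplit : f (a s * x) * f (b s * x) - f x -
      (p.eval (a s * x) * p.eval (b s * x) - p.eval x) =
      f (a s * x) * (f (b s * x) - p.eval (b s * x)) +
      (f (a s * x) - p.eval (a s * x)) * p.eval (b s * x) - (f x - p.eval x) := by ring
  have e1 : |f (a s * x) * (f (b s * x) - p.eval (b s * x))| ≤ B * (C * x ^ (n + 1)) := by
    rw [abs_mul]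
    exact mul_le_mul (hB _ (hmem h1)) (hle h2) (abs_nonneg _) hB0
  have e2 : |(f (a s * x) - p.eval (a s * x)) * p.eval (b s * x)| ≤ C * x ^ (n + 1) * B' := by
    rw [abs_mul]
    exact mul_le_mul (hle h1) (hB' _ (hmem h2)) (abs_nonneg _)
      (mul_nonneg hC (pow_nonneg hx.1 _))
  rw [hsplit]
  calc _ ≤ |f (a s * x) * (f (b s * x) - p.eval (b s * x))| +
        |(f (a s * x) - p.eval (a s * x)) * p.eval (b s * x)| + |f x - p.eval x| :=
        (abs_sub _ _).trans (add_le_add (abs_add_le _ _) le_rfl)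
    _ ≤ B * (C * x ^ (n + 1)) + C * x ^ (n + 1) * B' + C * x ^ (n + 1) :=
        add_le_add (add_le_add e1 e2) (hfp x hx)
    _ = _ := by ring

open Polynomial in
lemma neg_mul_integral_le_of_alternating {ν : Measure ℝ} {G a b : ℝ → ℝ} (hG : Integrable G ν)
    (hG0 : ∀ᵐ s ∂ν, 0 ≤ G s) (ha : Measurable a) (hb : Measurable b)
    (ha1 : ∀ᵐ s ∂ν, a s ∈ Set.Icc (0 : ℝ) 1) (hb1 : ∀ᵐ s ∂ν, b s ∈ Set.Icc (0 : ℝ) 1)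
    {p : ℝ[X]} (hp : ∀ k, 0 ≤ (-1) ^ k * p.coeff k) (n : ℕ) :
    -((-1) ^ n * p.coeff n) * ∫ s, G s ∂ν ≤
      (-1) ^ n * ∫ s, G s * (dilatedMulCoeff p n (a s) (b s) - p.coeff n) ∂ν := by
  rw [← integral_const_mul, ← integral_const_mul]
  refine integral_mono_ae (hG.const_mul _)
    ((integrable_mul_dilatedMulCoeff_sub hG ha hb ha1 hb1 p n _).const_mul _) ?_
  filter_upwards [hG0, ha1, hb1] with s h0 h1 h2
  have hnn : 0 ≤ (-1) ^ n * dilatedMulCoeff p n (a s) (b s) := by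
    rw [dilatedMulCoeff, Finset.mul_sum]
    refine Finset.sum_nonneg fun kl hkl ↦ ?_
    rw [← Finset.HasAntidiagonal.mem_antidiagonal.mp hkl]
    have := mul_nonneg (mul_nonneg (hp kl.1) (hp kl.2))
      (mul_nonneg (pow_nonneg h1.1 kl.1) (pow_nonneg h2.1 kl.2))
    refine this.trans_eq ?_
    ring
  have := mul_nonneg h0 hnn
  linarith

lemma exists_abs_sub_taylor_le {f : ℝ → ℝ} {U : Set ℝ} (hU : IsOpen U) {δ : ℝ} (hδ : 0 < δ)
    (hδU : Set.Icc 0 δ ⊆ U) (hf : ContDiffOn ℝ (⊤ : ℕ∞) f U) (n : ℕ) :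
    ∃ C, 0 ≤ C ∧ ∀ x ∈ Set.Icc 0 δ,
      |f x - ∑ k ∈ Finset.range (n + 1), iteratedDeriv k f 0 / k.factorial * x ^ k| ≤
        C * x ^ (n + 1) := by
  have h0 : (0 : ℝ) ∈ Set.Icc 0 δ := ⟨le_rfl, hδ.le⟩
  have htop (k : ℕ) : (k : WithTop ℕ∞) ≤ ((⊤ : ℕ∞) : WithTop ℕ∞) := by
    exact_mod_cast le_top
  obtain ⟨C, hC⟩ := exists_taylor_mean_remainder_bound (n := n) hδ.le
    ((hf.of_le (htop (n + 1))).mono hδU)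
  refine ⟨|C|, abs_nonneg _, fun x hx ↦ ?_⟩
  have h := hC x hx
  rw [taylor_within_apply, Real.norm_eq_abs, sub_zero] at h
  have hsum : ∑ k ∈ Finset.range (n + 1), ((k.factorial : ℝ)⁻¹ * x ^ k) •
      iteratedDerivWithin k f (Set.Icc 0 δ) 0 =
      ∑ k ∈ Finset.range (n + 1), iteratedDeriv k f 0 / k.factorial * x ^ k := by
    refine Finset.sum_congr rfl fun k _ ↦ ?_
    rw [iteratedDerivWithin_eq_iteratedDeriv (uniqueDiffOn_Icc hδ)
      ((hf.of_le (htop k)).contDiffAt (hU.mem_nhds (hδU h0))) h0, smul_eq_mul]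
    ring
  rw [hsum] at h
  exact h.trans (mul_le_mul_of_nonneg_right (le_abs_self C) (pow_nonneg hx.1 _))

open Polynomial in
/-- The Taylor polynomial of `f` at `0` of order `n`. -/
noncomputable def taylorPolynomialZero (f : ℝ → ℝ) (n : ℕ) : ℝ[X] :=
  ∑ k ∈ Finset.range (n + 1), C (iteratedDeriv k f 0 / k.factorial) * X ^ k

open Polynomial in
lemma coeff_taylorPolynomialZero (f : ℝ → ℝ) (n k : ℕ) :
    (taylorPolynomialZero f n).coeff k =
      if k ≤ n then iteratedDeriv k f 0 / k.factorial else 0 := by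
  simp [taylorPolynomialZero, coeff_C_mul, coeff_X_pow]

open Polynomial in
lemma natDegree_taylorPolynomialZero_le (f : ℝ → ℝ) (n : ℕ) :
    (taylorPolynomialZero f n).natDegree ≤ n :=
  natDegree_sum_le_of_forall_le _ _ fun k hk ↦
    (natDegree_C_mul_X_pow_le _ _).trans (by simpa [Nat.lt_succ_iff] using hk)

lemma mul_sum_taylor_deriv_eq (f : ℝ → ℝ) (m : ℕ) (x : ℝ) :
    x * ∑ k ∈ Finset.range (m + 1), iteratedDeriv k (deriv f) 0 / k.factorial * x ^ k =
      ∑ j ∈ Finset.range (2 * (m + 1) + 1),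
        j * (taylorPolynomialZero f (m + 1)).coeff j * x ^ j := by
  have hsub : Finset.range (m + 2) ⊆ Finset.range (2 * (m + 1) + 1) :=
    Finset.range_subset_range.mpr (by omega)
  rw [← Finset.sum_subset hsub, Finset.mul_sum, Finset.sum_range_succ' _ (m + 1)]
  · simp only [Nat.cast_zero, zero_mul, add_zero]
    refine Finset.sum_congr rfl fun k hk ↦ ?_
    have hk' : k + 1 ≤ m + 1 := by
      have := Finset.mem_range.mp hk
      omega
    rw [coeff_taylorPolynomialZero, if_pos hk', iteratedDeriv_succ', Nat.factorial_succ]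
    push_cast
    field_simp
    ring
  · intro j _ hj
    have hj' : ¬ j ≤ m + 1 := by
      rw [Finset.mem_range] at hj
      omega
    rw [coeff_taylorPolynomialZero, if_neg hj']
    ring

/-- Proposition 8.1 (non-existence of self-similar profiles with all moments finite):
for `μ > 0` there is no `ψ`, smooth near `0` with `ψ(0) = 1` and
`(-1)^n ψ^{(n)}(0) > 0` for all `n ≥ 1`, solving the generalized self-similar profile
equation. -/
theorem stmt15 (μ : ℝ) (hμ : 0 < μ)
    (G H a b c : ℝ → ℝ)
    (hG : ∀ s ∈ Set.Icc (0 : ℝ) 1, 0 ≤ G s)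
    (hH : ∀ s ∈ Set.Icc (0 : ℝ) 1, 0 ≤ H s)
    (hGint : IntervalIntegrable G MeasureTheory.volume 0 1)
    (hHint : IntervalIntegrable H MeasureTheory.volume 0 1)
    (ha : Measurable a) (hb : Measurable b) (hc : Measurable c)
    (ha1 : ∀ s ∈ Set.Icc (0 : ℝ) 1, a s ∈ Set.Icc (0 : ℝ) 1)
    (hb1 : ∀ s ∈ Set.Icc (0 : ℝ) 1, b s ∈ Set.Icc (0 : ℝ) 1)
    (hc1 : ∀ s ∈ Set.Icc (0 : ℝ) 1, c s ∈ Set.Icc (0 : ℝ) 1) :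
    ¬ ∃ ψ : ℝ → ℝ,
        (∃ U ∈ nhds (0 : ℝ), ContDiffOn ℝ (⊤ : ℕ∞) ψ U) ∧
        ψ 0 = 1 ∧
        (∀ n : ℕ, 1 ≤ n → 0 < (-1 : ℝ) ^ n * iteratedDeriv n ψ 0) ∧
        (∀ x : ℝ, 0 ≤ x →
          -μ * x * deriv ψ x
            = (∫ s in (0 : ℝ)..1, G s * (ψ (a s * x) * ψ (b s * x) - ψ x))
              + ∫ s in (0 : ℝ)..1, H s * (ψ (c s * x) - ψ x)) := by
  rintro ⟨ψ, ⟨U, hU, hψU⟩, hψ0, hsign, heq⟩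
  obtain ⟨V, hVU, hV, h0V⟩ := mem_nhds_iff.mp hU
  have hψ := hψU.mono hVU
  obtain ⟨ε, hε, hεV⟩ := Metric.isOpen_iff.mp hV 0 h0V
  obtain ⟨δ, hδ, hδε⟩ := exists_between hε
  have hδV : Set.Icc 0 δ ⊆ V := fun x hx ↦ hεV <| by
    rw [Metric.mem_ball, Real.dist_eq, sub_zero, abs_of_nonneg hx.1]
    exact hx.2.trans_lt hδε
  set ν : Measure ℝ := volume.restrict (Set.Ioc 0 1) with hν
  have hae {P : ℝ → Prop} (h : ∀ s ∈ Set.Icc (0 : ℝ) 1, P s) : ∀ᵐ s ∂ν, P s :=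
    (ae_restrict_mem measurableSet_Ioc).mono fun s hs ↦ h s (Set.Ioc_subset_Icc_self hs)
  have hGν : Integrable G ν := (intervalIntegrable_iff_integrableOn_Ioc_of_le zero_le_one).mp hGint
  have hHν : Integrable H ν := (intervalIntegrable_iff_integrableOn_Ioc_of_le zero_le_one).mp hHint
  have hz : ∀ᵐ s : ℝ ∂ν, (fun _ ↦ 0 : ℝ → ℝ) s ∈ Set.Icc (0 : ℝ) 1 :=
    Filter.Eventually.of_forall fun _ ↦ ⟨le_rfl, zero_le_one⟩
  obtain ⟨m, hm⟩ := exists_nat_gt (((∫ s, G s ∂ν) + ∫ s, H s ∂ν) / μ)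
  rw [div_lt_iff₀ hμ] at hm
  -- the order `m + 1` at which the equation for the Taylor coefficients is violated
  set p := taylorPolynomialZero ψ (m + 1) with hp
  have hpdeg := natDegree_taylorPolynomialZero_le ψ (m + 1)
  have hpsign (k : ℕ) : 0 ≤ (-1) ^ k * p.coeff k := by
    rw [hp, coeff_taylorPolynomialZero]
    split_ifs with hk
    · rcases Nat.eq_zero_or_pos k with rfl | hk0
      · simp [hψ0]
      · rw [← mul_div_assoc]
        exact div_nonneg (hsign k hk0).le (by positivity)
    · simp
  have hppos : 0 < (-1) ^ (m + 1) * p.coeff (m + 1) := by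
    rw [hp, coeff_taylorPolynomialZero, if_pos le_rfl, ← mul_div_assoc]
    exact div_pos (hsign _ (by omega)) (by positivity)
  -- a continuous function on the line which agrees with `ψ` on `[0, δ]`
  set f : ℝ → ℝ := fun x ↦ ψ (max 0 (min x δ)) with hf
  have hfcont : Continuous f :=
    (hψ.continuousOn.mono hδV).comp_continuous (by fun_prop)
      fun x ↦ ⟨le_max_left _ _, max_le hδ.le (min_le_right _ _)⟩
  have hfψ {x : ℝ} (hx : x ∈ Set.Icc 0 δ) : f x = ψ x := by
    simp only [hf, min_eq_left hx.2, max_eq_right hx.1]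
  obtain ⟨C, hC, hCψ⟩ := exists_abs_sub_taylor_le hV hδ hδV hψ (m + 1)
  have hfp : ∀ x ∈ Set.Icc 0 δ, |f x - p.eval x| ≤ C * x ^ (m + 1 + 1) := fun x hx ↦ by
    rw [hfψ hx]
    simpa [hp, taylorPolynomialZero, Polynomial.eval_finsetSum] using hCψ x hx
  obtain ⟨D, -, hD⟩ := exists_abs_sub_taylor_le hV hδ hδV
    (hψ.deriv_of_isOpen hV (m := ((⊤ : ℕ∞) : WithTop ℕ∞)) le_rfl) m
  obtain ⟨KG, hKG⟩ := exists_abs_integral_sub_sum_le hGν ha hb (hae ha1) (hae hb1) hfcont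
    hpdeg hC hfp
  obtain ⟨KH, hKH⟩ := exists_abs_integral_sub_sum_le hHν hc measurable_const (hae hc1) hz hfcont
    hpdeg hC hfp
  have hr := coeff_eq_zero_of_abs_sum_le (K := μ * D + KG + KH) hδ (m + 1)
    (N := 2 * (m + 1) + 1)
    (r := fun j ↦ μ * (j * p.coeff j) +
      (∫ s, G s * (dilatedMulCoeff p j (a s) (b s) - p.coeff j) ∂ν) +
      ∫ s, H s * (dilatedMulCoeff p j (c s) 0 - p.coeff j) ∂ν) ?_ (m + 1) le_rfl (by omega)
  · have eG := neg_mul_integral_le_of_alternating hGν (hae hG) ha hb (hae ha1) (hae hb1)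
      hpsign (m + 1)
    have eH := neg_mul_integral_le_of_alternating hHν (hae hH) hc measurable_const (hae hc1) hz
      hpsign (m + 1)
    have hr' := congrArg (fun y ↦ (-1) ^ (m + 1) * y) hr
    simp only [mul_add, mul_zero] at hr'
    push_cast at hr'
    have := mul_pos hppos (sub_pos.mpr (hm.trans_le (mul_le_mul_of_nonneg_right
      (by linarith : (m : ℝ) ≤ m + 1) hμ.le)))
    linarith
  · intro x hx
    have hx' : x ∈ Set.Icc 0 δ := ⟨hx.1.le, hx.2⟩
    have hmem {t : ℝ} (ht : t ∈ Set.Icc (0 : ℝ) 1) : t * x ∈ Set.Icc 0 δ :=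
      ⟨mul_nonneg ht.1 hx'.1, (mul_le_of_le_one_left hx'.1 ht.2).trans hx'.2⟩
    have hE := heq x hx'.1
    rw [intervalIntegral.integral_of_le zero_le_one, intervalIntegral.integral_of_le zero_le_one,
      ← hν] at hE
    have hGf : ∫ s, G s * (ψ (a s * x) * ψ (b s * x) - ψ x) ∂ν =
        ∫ s, G s * (f (a s * x) * f (b s * x) - f x) ∂ν := by
      refine integral_congr_ae ?_
      filter_upwards [hae ha1, hae hb1] with s h1 h2
      rw [hfψ (hmem h1), hfψ (hmem h2), hfψ hx']
    have hHf : ∫ s, H s * (ψ (c s * x) - ψ x) ∂ν =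
        ∫ s, H s * (f (c s * x) * f (0 * x) - f x) ∂ν := by
      refine integral_congr_ae ?_
      filter_upwards [hae hc1] with s h1
      rw [hfψ (hmem h1), hfψ (hmem ⟨le_rfl, zero_le_one⟩), hfψ hx', zero_mul, hψ0, mul_one]
    have hDx : |x * deriv ψ x - ∑ j ∈ Finset.range (2 * (m + 1) + 1), j * p.coeff j * x ^ j| ≤
        D * x ^ (m + 1 + 1) := by
      rw [hp, ← mul_sum_taylor_deriv_eq, ← mul_sub, abs_mul, abs_of_pos hx.1]
      refine (mul_le_mul_of_nonneg_left (hD x hx') hx'.1).trans_eq ?_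
      ring
    have hG' := hKG x hx'
    have hH' := hKH x hx'
    rw [hGf, hHf] at hE
    have hsum : ∑ j ∈ Finset.range (2 * (m + 1) + 1), (μ * (j * p.coeff j) +
        (∫ s, G s * (dilatedMulCoeff p j (a s) (b s) - p.coeff j) ∂ν) +
        ∫ s, H s * (dilatedMulCoeff p j (c s) 0 - p.coeff j) ∂ν) * x ^ j =
        μ * ∑ j ∈ Finset.range (2 * (m + 1) + 1), j * p.coeff j * x ^ j +
        ∑ j ∈ Finset.range (2 * (m + 1) + 1),
          (∫ s, G s * (dilatedMulCoeff p j (a s) (b s) - p.coeff j) ∂ν) * x ^ j +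
        ∑ j ∈ Finset.range (2 * (m + 1) + 1),
          (∫ s, H s * (dilatedMulCoeff p j (c s) 0 - p.coeff j) ∂ν) * x ^ j := by
      rw [Finset.mul_sum, ← Finset.sum_add_distrib, ← Finset.sum_add_distrib]
      exact Finset.sum_congr rfl fun j _ ↦ by ring
    rw [hsum]
    rw [abs_le] at hDx hG' hH' ⊢
    have d1 := mul_le_mul_of_nonneg_left hDx.1 hμ.le
    have d2 := mul_le_mul_of_nonneg_left hDx.2 hμ.le
    constructor <;> linarith [hG'.1, hG'.2, hH'.1, hH'.2]
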